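/- arXiv:2104.00913 — 2 statements merged into one kernel-verified Lean document; each statement's English description precedes it below -/
import Mathlib

section
/- Let f = (f_1,…,f_p) with f_i ∈ ℂ[z_1,…,z_n] be a dominant polynomial mapping. Then K_∞(f) has codimension at least 1 in ℂ^p; in particular K_∞(f) is not Zariski dense in ℂ^p, i.e., there exists a nonzero polynomial g ∈ ℂ[c_1,…,c_p] that vanishes identically on K_∞(f). -/
open MvPolynomial Filter

/-- Euclidean norm on `ℂ^m`. -/
noncomputable def eucNorm {m : ℕ} (v : Fin m → ℂ) : ℝ :=
  Real.sqrt (∑ k, ‖v k‖ ^ 2)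

/-- The differential of `f_j` at `x` applied to `v`. -/
noncomputable def pdiff {n p : ℕ} (f : Fin p → MvPolynomial (Fin n) ℂ)
    (x : Fin n → ℂ) (j : Fin p) (v : Fin n → ℂ) : ℂ :=
  ∑ k, MvPolynomial.eval x (MvPolynomial.pderiv k (f j)) * v k

/-- Operator norm of `w_j(x)`, the restriction of `df_j(x)` to the kernel of
`v ↦ (df_i(x) v)_{i ≠ j}`. -/
noncomputable def wNorm {n p : ℕ} (f : Fin p → MvPolynomial (Fin n) ℂ)
    (x : Fin n → ℂ) (j : Fin p) : ℝ :=
  sSup { r : ℝ | ∃ v : Fin n → ℂ,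
    (∀ i : Fin p, i ≠ j → pdiff f x i v = 0) ∧ eucNorm v ≤ 1 ∧ r = ‖pdiff f x j v‖ }

/-- The Kuo distance `κ(df(x)) = min_{1 ≤ j ≤ p} ‖w_j(x)‖`. -/
noncomputable def kuoDist {n p : ℕ} (f : Fin p → MvPolynomial (Fin n) ℂ)
    (x : Fin n → ℂ) : ℝ :=
  ⨅ j : Fin p, wNorm f x j

/-- The set of asymptotic critical values of the polynomial map `f : ℂ^n → ℂ^p`. -/
def Kinf {n p : ℕ} (f : Fin p → MvPolynomial (Fin n) ℂ) : Set (Fin p → ℂ) :=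
  { c | ∃ x : ℕ → (Fin n → ℂ),
      Tendsto (fun t => eucNorm (x t)) atTop atTop ∧
      Tendsto (fun t j => MvPolynomial.eval (x t) (f j)) atTop (nhds c) ∧
      Tendsto (fun t => eucNorm (x t) * kuoDist f (x t)) atTop (nhds 0) }

/-- Taylor expansion: if `π` is a non-zero divisor with residue field `k` and the powers of `π`
have trivial intersection, then `V` embeds into the power series ring. -/
theorem exists_algHom_powerSeries (k V : Type*) [Field k] [CommRing V] [IsDomain V] [Algebra k V]
    (π : V) (hres : ∀ v : V, ∃ c : k, π ∣ v - algebraMap k V c)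
    (hπ : π ≠ 0) (hu : ¬ IsUnit π) (hsep : ∀ v : V, (∀ n, π ^ n ∣ v) → v = 0) :
    ∃ φ : V →ₐ[k] PowerSeries k, Function.Injective φ ∧
      ∀ v, π ∣ v → PowerSeries.constantCoeff (φ v) = 0 := by
  let T : ℕ → PowerSeries k → V := fun n F => (F.trunc n).aeval π
  have hex : ∀ v : V, ∃ F : PowerSeries k, ∀ n, π ^ n ∣ v - T n F := by
    choose c hc using hres
    choose s hs using hc
    intro v
    refine ⟨PowerSeries.mk fun n => c (s^[n] v), fun n => ⟨s^[n] v, ?_⟩⟩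
    induction n with
    | zero => simp [T]
    | succ n ih =>
      have h1 := hs (s^[n] v)
      rw [Function.iterate_succ_apply']
      simp only [T, PowerSeries.trunc_succ, map_add, Polynomial.aeval_monomial,
        PowerSeries.coeff_mk] at ih ⊢
      linear_combination ih + π ^ n * h1
  have hcst : ∀ c : k, π ∣ algebraMap k V c → c = 0 := by
    intro c hc
    by_contra h
    exact hu (isUnit_of_dvd_unit hc ((IsUnit.mk0 c h).map _))
  have huniq0 : ∀ F : PowerSeries k, (∀ n, π ^ n ∣ T n F) → F = 0 := by
    intro F hF
    have key : ∀ n, PowerSeries.trunc n F = 0 := by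
      intro n
      induction n with
      | zero => simp
      | succ n ih =>
        have := hF (n + 1)
        simp only [T, PowerSeries.trunc_succ, ih, zero_add, Polynomial.aeval_monomial] at this
        rw [pow_succ, mul_comm (algebraMap k V _)] at this
        have := hcst _ ((mul_dvd_mul_iff_left (pow_ne_zero n hπ)).1 this)
        rw [PowerSeries.trunc_succ, ih, this]; simp
    ext n
    have := congrArg (fun p => Polynomial.coeff p n) (key (n + 1))
    simpa [PowerSeries.coeff_trunc] using this
  have huniq : ∀ v F G, (∀ n, π ^ n ∣ v - T n F) → (∀ n, π ^ n ∣ v - T n G) → F = G := by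
    intro v F G hF hG
    rw [← sub_eq_zero]
    refine huniq0 _ fun n => ?_
    have := dvd_sub (hG n) (hF n)
    simpa [T, PowerSeries.trunc_sub] using this
  choose φ hφ using hex
  have hone : ∀ c : k, φ (algebraMap k V c) = algebraMap k _ c := by
    intro c
    refine huniq _ _ _ (hφ _) fun n => ?_
    cases n with
    | zero => simp
    | succ n =>
      simp only [T]
      rw [PowerSeries.algebraMap_apply, Algebra.algebraMap_self_apply, PowerSeries.trunc_C]
      simp
  have hmul : ∀ v w, φ (v * w) = φ v * φ w := by
    intro v w
    refine huniq _ _ _ (hφ _) fun n => ?_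
    have h1 : π ^ n ∣ v * w - T n (φ v) * T n (φ w) := by
      have := dvd_add ((hφ v n).mul_right w) ((hφ w n).mul_left (T n (φ v)))
      convert this using 1; ring
    have h2 : π ^ n ∣ T n (φ v) * T n (φ w) - T n (φ v * φ w) := by
      have : (Polynomial.X : Polynomial k) ^ n ∣
          PowerSeries.trunc n (φ v) * PowerSeries.trunc n (φ w) -
            PowerSeries.trunc n (φ v * φ w) := by
        rw [Polynomial.X_pow_dvd_iff]
        intro d hd
        have := PowerSeries.coeff_mul_eq_coeff_trunc_mul_trunc (φ v) (φ w) hd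
        rw [Polynomial.coeff_sub, PowerSeries.coeff_trunc, if_pos hd, this,
          ← Polynomial.coeff_coe, sub_eq_zero]
        simp
      have := map_dvd (Polynomial.aeval π) this
      simpa [T] using this
    convert dvd_add h1 h2 using 1; ring
  have hadd : ∀ v w, φ (v + w) = φ v + φ w := by
    intro v w
    refine huniq _ _ _ (hφ _) fun n => ?_
    convert dvd_add (hφ v n) (hφ w n) using 1
    simp only [T, map_add]; ring
  let Φ : V →ₐ[k] PowerSeries k :=
    { toFun := φ
      map_one' := by simpa using hone 1
      map_mul' := hmul
      map_zero' := by simpa using hone 0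
      map_add' := hadd
      commutes' := hone }
  refine ⟨Φ, ?_, ?_⟩
  · rw [injective_iff_map_eq_zero]
    intro v hv
    refine hsep v fun n => ?_
    have h := hφ v n
    rw [show φ v = 0 from hv] at h
    simpa [T] using h
  · intro v hv
    have h := hφ v 1
    have h2 : T 1 (φ v) = algebraMap k V (PowerSeries.constantCoeff (φ v)) := by
      simp [T, PowerSeries.trunc_succ]
    rw [pow_one, h2] at h
    exact hcst _ ((dvd_sub_right hv).1 h)

open Polynomial in
/-- A one-dimensional affine domain embeds into a power series ring centred at any of its
points. -/
theorem exists_algHom_powerSeries_of_finite (k E : Type*) [Field k] [IsAlgClosed k] [CharZero k]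
    [CommRing E] [IsDomain E] [Algebra k E] [Algebra k[X] E] [IsScalarTower k k[X] E]
    [Module.Finite k[X] E] [FaithfulSMul k[X] E] (M : Ideal E) [M.IsPrime] (hM : M ≠ ⊥) :
    ∃ φ : E →ₐ[k] PowerSeries k, Function.Injective φ ∧
      ∀ v ∈ M, PowerSeries.constantCoeff (φ v) = 0 := by
  let F := FractionRing E
  let K := FractionRing k[X]
  let _ : Algebra K F := FractionRing.liftAlgebra k[X] F
  have : CharZero K := charZero_of_injective_algebraMap (FaithfulSMul.algebraMap_injective k[X] _)
  have : FiniteDimensional K F := by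
    have : Algebra.EssFiniteType E F := .of_isLocalization F (nonZeroDivisors E)
    have : Algebra.EssFiniteType k[X] F := .comp k[X] E F
    have : Algebra.EssFiniteType K F := .of_comp k[X] K F
    have : Algebra.IsAlgebraic K F := isAlgebraic_of_isFractionRing k[X] E K F
    exact Algebra.finite_of_essFiniteType_of_isAlgebraic
  let S := integralClosure k[X] F
  have : IsDedekindDomain S := integralClosure.isDedekindDomain k[X] K F
  have : Module.Finite k[X] S := IsIntegralClosure.finite k[X] K F S
  have hint : ∀ e : E, IsIntegral k[X] (algebraMap E F e) := fun e =>
    (Algebra.IsIntegral.isIntegral e).map (IsScalarTower.toAlgHom k[X] E F)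
  let j : E →ₐ[k[X]] S := (IsScalarTower.toAlgHom k[X] E F).codRestrict _ hint
  have hj : Function.Injective j := fun a b h =>
    IsFractionRing.injective E F (congrArg Subtype.val h)
  let _ : Algebra E S := j.toRingHom.toAlgebra
  have : IsScalarTower k[X] E S := IsScalarTower.of_algebraMap_eq' j.comp_algebraMap.symm
  have : Algebra.IsIntegral E S := Algebra.IsIntegral.tower_top k[X]
  obtain ⟨N, -, hN, hNM⟩ := Ideal.exists_ideal_over_prime_of_isIntegral (S := S) M ⊥ (by
    exact (Ideal.comap_bot_of_injective (algebraMap E S) hj).le.trans bot_le)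
  have hN0 : N ≠ ⊥ := by
    rintro rfl
    exact hM (hNM.symm.trans (Ideal.comap_bot_of_injective (algebraMap E S) hj))
  have hNmax : N.IsMaximal := hN.isMaximal hN0
  have : Algebra.FiniteType k S := Algebra.FiniteType.trans (S := k[X]) inferInstance inferInstance
  let _ : Field (S ⧸ N) := Ideal.Quotient.field N
  have : Module.Finite k (S ⧸ N) := finite_of_finite_type_of_isJacobsonRing k (S ⧸ N)
  have hbij : Function.Bijective (algebraMap k (S ⧸ N)) :=
    IsAlgClosed.algebraMap_bijective_of_isIntegral
  let V := Localization.AtPrime N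
  have : IsDiscreteValuationRing V :=
    IsLocalization.AtPrime.isDiscreteValuationRing_of_dedekind_domain S hN0 V
  obtain ⟨π, hπ⟩ := IsDiscreteValuationRing.exists_irreducible V
  have hmax : ∀ v : V, π ∣ v ↔ v ∈ IsLocalRing.maximalIdeal V := fun v => by
    rw [hπ.maximalIdeal_eq, Ideal.mem_span_singleton]
  have hSV : ∀ s : S, s ∈ N → π ∣ algebraMap S V s := fun s hs => by
    rw [hmax]; exact (IsLocalization.AtPrime.to_map_mem_maximal_iff V N s).2 hs
  obtain ⟨φ, hφ, hφ0⟩ := exists_algHom_powerSeries k V π (fun v => by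
    obtain ⟨s, hs⟩ := (IsLocalization.AtPrime.equivQuotMaximalIdeal N V).surjective
      (Ideal.Quotient.mk _ v)
    obtain ⟨c, hc⟩ := hbij.2 s
    refine ⟨c, ?_⟩
    rw [hmax]
    refine (Ideal.Quotient.mk_eq_mk_iff_sub_mem v (algebraMap k V c)).1 ?_
    rw [← hs, ← hc]
    rfl) hπ.ne_zero hπ.not_isUnit (fun v hv => by
    have : v ∈ (⨅ n : ℕ, Ideal.span {π} ^ n) := by
      simpa [Ideal.mem_iInf, Ideal.span_singleton_pow, Ideal.mem_span_singleton] using hv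
    have hbot := Ideal.iInf_pow_eq_bot_of_isDomain (Ideal.span {π}) (by
      rw [Ne, Ideal.span_singleton_eq_top]; exact hπ.not_isUnit)
    exact (Submodule.mem_bot V).1 (hbot.le this))
  refine ⟨(φ.comp (IsScalarTower.toAlgHom k S V)).comp (j.restrictScalars k), ?_, ?_⟩
  · exact hφ.comp ((IsLocalization.injective V N.primeCompl_le_nonZeroDivisors).comp hj)
  · intro v hv
    refine hφ0 _ (hSV _ ?_)
    rw [← hNM] at hv
    exact hv

/-- Curve selection: through every closed point of an affine variety there is a formal arc along
which a given nonzero function does not vanish identically. -/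
theorem exists_algHom_powerSeries_of_isMaximal (k B : Type*) [Field k] [IsAlgClosed k] [CharZero k]
    [CommRing B] [IsDomain B] [Algebra k B] [Algebra.FiniteType k B] (M : Ideal B) [M.IsMaximal]
    (h : B) (hM : h ∈ M) (h0 : h ≠ 0) :
    ∃ φ : B →ₐ[k] PowerSeries k, φ h ≠ 0 ∧ ∀ v ∈ M, PowerSeries.constantCoeff (φ v) = 0 := by
  obtain ⟨d, g, hg, hfin⟩ := exists_finite_inj_algHom_of_fg k B
  let _ : Algebra (MvPolynomial (Fin d) k) B := g.toRingHom.toAlgebra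
  have : IsScalarTower k (MvPolynomial (Fin d) k) B := .of_algebraMap_eq' g.comp_algebraMap.symm
  have : Module.Finite (MvPolynomial (Fin d) k) B := hfin
  have : FaithfulSMul (MvPolynomial (Fin d) k) B :=
    (faithfulSMul_iff_algebraMap_injective (MvPolynomial (Fin d) k) B).2 hg
  have hI : (Ideal.span {h}).comap (algebraMap (MvPolynomial (Fin d) k) B) ≠ ⊥ :=
    Ideal.comap_ne_bot_of_integral_mem h0 (Ideal.mem_span_singleton_self h)
      (Algebra.IsIntegral.isIntegral h)
  obtain ⟨a, ha, ha0⟩ := Submodule.exists_mem_ne_zero_of_ne_bot hI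
  have hmax : (M.comap (algebraMap (MvPolynomial (Fin d) k) B)).IsMaximal := inferInstance
  obtain ⟨p0, hp0⟩ := (MvPolynomial.isMaximal_iff_eq_vanishingIdeal_singleton (K := k)).1 hmax
  have hmem : ∀ b : MvPolynomial (Fin d) k,
      algebraMap (MvPolynomial (Fin d) k) B b ∈ M ↔ MvPolynomial.eval p0 b = 0 := fun b => by
    rw [← Ideal.mem_comap, hp0, MvPolynomial.mem_vanishingIdeal_singleton_iff,
      MvPolynomial.aeval_eq_eval]
  obtain ⟨w, hw⟩ : ∃ w, MvPolynomial.eval w a ≠ 0 := by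
    by_contra! H
    exact ha0 (MvPolynomial.funext fun x => by simpa using H x)
  have hap : MvPolynomial.eval p0 a = 0 := (hmem a).1
    ((Ideal.span_singleton_le_iff_mem M).2 hM ha)
  let θ : MvPolynomial (Fin d) k →ₐ[k] Polynomial k := MvPolynomial.aeval fun i =>
    Polynomial.C (p0 i) + Polynomial.C (w i - p0 i) * Polynomial.X
  have heval : ∀ (c : k) (b : MvPolynomial (Fin d) k),
      Polynomial.eval c (θ b) = MvPolynomial.eval (fun i => p0 i + (w i - p0 i) * c) b := by
    intro c b
    have : (Polynomial.aeval c).comp θ =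
        MvPolynomial.aeval (R := k) (fun i => p0 i + (w i - p0 i) * c) :=
      MvPolynomial.algHom_ext fun i => by simp [θ]
    have h2 := DFunLike.congr_fun this b
    rwa [AlgHom.comp_apply, Polynomial.coe_aeval_eq_eval, MvPolynomial.aeval_eq_eval] at h2
  obtain ⟨i, hi⟩ : ∃ i, w i - p0 i ≠ 0 := by
    by_contra! H
    exact hw (by rwa [show w = p0 from funext fun i => sub_eq_zero.1 (H i)])
  have hθ : Function.Surjective θ := by
    intro q
    refine ⟨Polynomial.aeval (MvPolynomial.C (w i - p0 i)⁻¹ *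
      (MvPolynomial.X i - MvPolynomial.C (p0 i))) q, ?_⟩
    rw [← AlgHom.comp_apply]
    have : θ.comp (Polynomial.aeval (MvPolynomial.C (w i - p0 i)⁻¹ *
        (MvPolynomial.X i - MvPolynomial.C (p0 i)))) = AlgHom.id k _ := by
      refine Polynomial.algHom_ext ?_
      simp only [AlgHom.comp_apply, Polynomial.aeval_X, map_mul, map_sub, θ,
        MvPolynomial.aeval_X, MvPolynomial.aeval_C, AlgHom.id_apply, Polynomial.algebraMap_eq]
      rw [add_sub_cancel_left, ← mul_assoc, ← Polynomial.C_sub, ← Polynomial.C_mul,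
        inv_mul_cancel₀ hi, Polynomial.C_1, one_mul]
    rw [this]; rfl
  let P : Ideal (MvPolynomial (Fin d) k) := RingHom.ker θ
  have hP : P.IsPrime := RingHom.ker_isPrime _
  have hPM : P ≤ M.comap (algebraMap (MvPolynomial (Fin d) k) B) := fun b hb => by
    rw [Ideal.mem_comap, hmem]
    have := heval 0 b
    rw [show θ b = 0 from hb] at this
    simpa using this.symm
  have haP : a ∉ P := fun hb => hw (by
    have := heval 1 a
    rw [show θ a = 0 from hb] at this
    simpa using this.symm)
  have : Algebra.HasGoingDown (MvPolynomial (Fin d) k) B := inferInstance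
  have : M.LiesOver (M.comap (algebraMap (MvPolynomial (Fin d) k) B)) := ⟨rfl⟩
  obtain ⟨q, hqM, hq, hqP⟩ := Ideal.exists_ideal_le_liesOver_of_le
    (q := M.comap (algebraMap (MvPolynomial (Fin d) k) B)) M hPM
  have hhq : h ∉ q := fun hh => haP (by
    rw [hqP.over]
    exact (Ideal.span_singleton_le_iff_mem q).2 hh ha)
  let e : (MvPolynomial (Fin d) k ⧸ P) ≃ₐ[k] Polynomial k :=
    Ideal.quotientKerAlgEquivOfSurjective hθ
  have he : ∀ c, e.symm (θ c) = Ideal.Quotient.mk P c := fun c => by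
    rw [AlgEquiv.symm_apply_eq]; rfl
  let L : (MvPolynomial (Fin d) k ⧸ P) →ₐ[k] B ⧸ q := Ideal.Quotient.liftₐ P
    ((Ideal.Quotient.mkₐ k q).comp (IsScalarTower.toAlgHom k (MvPolynomial (Fin d) k) B))
    fun c hc => Ideal.Quotient.eq_zero_iff_mem.2 (by rw [hqP.over] at hc; exact hc)
  let ψ : Polynomial k →ₐ[k] B ⧸ q := L.comp e.symm
  have hψ : ∀ c, ψ (θ c) = Ideal.Quotient.mk q (algebraMap (MvPolynomial (Fin d) k) B c) :=
    fun c => (congrArg L (he c)).trans rfl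
  let _ : Algebra (Polynomial k) (B ⧸ q) := ψ.toRingHom.toAlgebra
  have : IsScalarTower k (Polynomial k) (B ⧸ q) := .of_algebraMap_eq' ψ.comp_algebraMap.symm
  have : Module.Finite (Polynomial k) (B ⧸ q) := by
    refine RingHom.Finite.of_comp_finite (f := θ.toRingHom) (g := ψ.toRingHom) ?_
    have : ψ.toRingHom.comp θ.toRingHom =
        (Ideal.Quotient.mk q).comp (algebraMap (MvPolynomial (Fin d) k) B) :=
      RingHom.ext hψ
    rw [this]
    exact (RingHom.Finite.of_surjective _ Ideal.Quotient.mk_surjective).comp hfin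
  have : FaithfulSMul (Polynomial k) (B ⧸ q) := (faithfulSMul_iff_algebraMap_injective _ _).2 <|
    (injective_iff_map_eq_zero ψ.toRingHom).2 fun x hx => by
      obtain ⟨c, rfl⟩ := hθ x
      have h1 : Ideal.Quotient.mk q (algebraMap (MvPolynomial (Fin d) k) B c) = 0 :=
        (hψ c).symm.trans hx
      rw [Ideal.Quotient.eq_zero_iff_mem] at h1
      have h2 : c ∈ P := by rw [hqP.over]; exact h1
      exact h2
  have hM' : (M.map (Ideal.Quotient.mk q)).IsPrime :=
    Ideal.map_isPrime_of_surjective Ideal.Quotient.mk_surjective (by rwa [Ideal.mk_ker])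
  obtain ⟨φ, hφ, hφ0⟩ := exists_algHom_powerSeries_of_finite k (B ⧸ q) (M.map (Ideal.Quotient.mk q))
    fun H => hhq (Ideal.Quotient.eq_zero_iff_mem.1 ((Submodule.mem_bot _).1
      (H.le (Ideal.mem_map_of_mem _ hM))))
  refine ⟨φ.comp (Ideal.Quotient.mkₐ k q), fun H => hhq ?_, fun v hv => hφ0 _ ?_⟩
  · exact Ideal.Quotient.eq_zero_iff_mem.1 (hφ (H.trans (map_zero φ).symm))
  · exact Ideal.mem_map_of_mem _ hv

/-- Partial derivatives extend to algebraic extensions of the rational function field. -/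
theorem exists_derivation_apply_X {ι : Type*} [DecidableEq ι] (k : Type*) [Field k] [Algebra ℂ k]
    [Algebra (MvPolynomial ι ℂ) k] [IsScalarTower ℂ (MvPolynomial ι ℂ) k]
    [FaithfulSMul (MvPolynomial ι ℂ) k] [Algebra.IsAlgebraic (MvPolynomial ι ℂ) k] (i : ι) :
    ∃ D : Derivation ℂ k k, ∀ j, D (algebraMap (MvPolynomial ι ℂ) k (X j)) =
      if j = i then 1 else 0 := by
  let _ := FractionRing.liftAlgebra (MvPolynomial ι ℂ) k
  have : CharZero (FractionRing (MvPolynomial ι ℂ)) :=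
    charZero_of_injective_algebraMap (FaithfulSMul.algebraMap_injective ℂ _)
  have : Algebra.IsAlgebraic (FractionRing (MvPolynomial ι ℂ)) k :=
    Algebra.IsAlgebraic.extendScalars (IsFractionRing.injective (MvPolynomial ι ℂ) _)
  have : Algebra.FormallyEtale (FractionRing (MvPolynomial ι ℂ)) k :=
    Algebra.FormallyEtale.of_isSeparable _ _
  have : Algebra.FormallyEtale (MvPolynomial ι ℂ) (FractionRing (MvPolynomial ι ℂ)) :=
    Algebra.FormallyEtale.of_isLocalization (nonZeroDivisors _)
  have : Algebra.FormallyEtale (MvPolynomial ι ℂ) k :=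
    Algebra.FormallyEtale.comp _ (FractionRing (MvPolynomial ι ℂ)) k
  let e := KaehlerDifferential.tensorKaehlerEquivOfFormallyEtale ℂ (MvPolynomial ι ℂ) k
  let d : Derivation ℂ (MvPolynomial ι ℂ) k := MvPolynomial.mkDerivation ℂ (Pi.single i 1)
  let l : TensorProduct (MvPolynomial ι ℂ) k Ω[MvPolynomial ι ℂ⁄ℂ] →ₗ[k] k :=
    LinearMap.liftBaseChange k d.liftKaehlerDifferential
  refine ⟨(l.comp e.symm.toLinearMap).compDer (KaehlerDifferential.D ℂ k), fun j => ?_⟩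
  simp [e, KaehlerDifferential.tensorKaehlerEquivOfFormallyEtale_symm_D_algebraMap, l, d,
    Pi.single_apply]

theorem LaurentSeries.map_derivation_mul {R k : Type*} [CommRing R] [Field k] [Algebra R k]
    (D : Derivation R k k) (x y : LaurentSeries k) :
    HahnSeries.map (x * y) D = x * HahnSeries.map y D + HahnSeries.map x D * y := by
  ext n
  have hx : (HahnSeries.map x D).support ⊆ x.support := fun m hm hx => hm (by simp [hx])
  have hy : (HahnSeries.map y D).support ⊆ y.support := fun m hm hy => hm (by simp [hy])
  rw [HahnSeries.coeff_add, HahnSeries.coeff_mul_left' x.isPWO_support hx,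
    HahnSeries.coeff_mul_right' y.isPWO_support hy, ← Finset.sum_add_distrib,
    HahnSeries.map_coeff, HahnSeries.coeff_mul, map_sum]
  refine Finset.sum_congr rfl fun ij _ => ?_
  simp [mul_comm]

theorem LaurentSeries.orderTop_le_map_derivation {R k : Type*} [CommRing R] [Field k] [Algebra R k]
    (D : Derivation R k k) (x : LaurentSeries k) :
    x.orderTop ≤ (HahnSeries.map x D).orderTop := by
  rw [HahnSeries.le_orderTop_iff_forall]
  intro n hn
  simp [HahnSeries.coeff_eq_zero_of_lt_orderTop hn]

theorem LaurentSeries.map_derivation_C {R k : Type*} [CommRing R] [Field k] [Algebra R k]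
    (D : Derivation R k k) (c : k) :
    HahnSeries.map (HahnSeries.C c : LaurentSeries k) D = HahnSeries.C (D c) := by
  ext n
  by_cases h : n = 0 <;> simp [HahnSeries.C_apply, h]

theorem LaurentSeries.map_derivation_eval₂ {k : Type*} [Field k] [Algebra ℂ k]
    (D : Derivation ℂ k k) {σ : Type*} [Fintype σ] (x : σ → LaurentSeries k)
    (f : MvPolynomial σ ℂ) :
    let ι : ℂ →+* LaurentSeries k := HahnSeries.C.comp (algebraMap ℂ k)
    HahnSeries.map (eval₂ ι x f) D =
      ∑ l, eval₂ ι x (pderiv l f) * HahnSeries.map (x l) D := by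
  classical
  intro ι
  induction f using MvPolynomial.induction_on with
  | C a => rw [eval₂_C, show ι a = HahnSeries.C (algebraMap ℂ k a) from rfl,
      LaurentSeries.map_derivation_C]; simp
  | add p q hp hq =>
    simp only [eval₂_add, map_add, add_mul, Finset.sum_add_distrib, ← hp, ← hq]
    ext; simp
  | mul_X p i hp =>
    simp only [eval₂_mul, eval₂_X, LaurentSeries.map_derivation_mul, hp, Derivation.leibniz,
      pderiv_X, smul_eq_mul, eval₂_add, add_mul, Finset.sum_add_distrib]
    congr 1
    · rw [Finset.sum_eq_single i]
      · simp
      · intro b _ hb; simp [hb.symm]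
      · simp
    · rw [Finset.sum_mul]
      refine Finset.sum_congr rfl fun l _ => ?_
      ring

/-- If the `f i` are constants of the field `k`, one of which has derivative `1`, then the
combination of gradients and its multiples by the coordinates cannot all vanish at a point of the
algebra that they generate together with the multipliers. -/
theorem one_mem_span_of_derivation {σ τ : Type*} [Fintype σ] [Fintype τ] [DecidableEq τ]
    {k L : Type*} [Field k] [Field L] [IsAlgClosed k] [Algebra ℂ k] [Algebra ℂ L] [Algebra k L]
    [IsScalarTower ℂ k L] (f : τ → MvPolynomial σ ℂ) (x : σ → L) (μ : τ → L) (h : σ → L)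
    (c : τ → k) (i₀ : τ) (D : Derivation ℂ k k)
    (hD : ∀ i, D (c i) = if i = i₀ then 1 else 0) (hμ : μ i₀ = 1)
    (hc : ∀ i, aeval x (f i) = algebraMap k L (c i))
    (hh : ∀ l, h l = ∑ i, μ i * aeval x (pderiv l (f i))) {l₀ : σ} (hl₀ : h l₀ ≠ 0) :
    (1 : L) ∈ Submodule.span
      (Algebra.adjoin k (Set.range μ ∪ (Set.range h ∪ Set.range fun q : σ × σ => x q.1 * h q.2)))
      (Set.range h ∪ Set.range fun q : σ × σ => x q.1 * h q.2) := by
  set G : Set L := Set.range h ∪ Set.range fun q : σ × σ => x q.1 * h q.2 with hG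
  set B := Algebra.adjoin k (Set.range μ ∪ G) with hB
  by_contra hone
  have : CharZero k := charZero_of_injective_algebraMap (FaithfulSMul.algebraMap_injective ℂ k)
  have : Algebra.FiniteType k B := B.fg_iff_finiteType.1
    (Subalgebra.fg_def.2 ⟨_, (Set.finite_range μ).union
      ((Set.finite_range h).union (Set.finite_range _)), rfl⟩)
  have hμB : ∀ i, μ i ∈ B := fun i => Algebra.subset_adjoin (.inl ⟨i, rfl⟩)
  have hGB : ∀ g ∈ G, g ∈ B := fun g hg => Algebra.subset_adjoin (.inr hg)
  have hhG : ∀ l, h l ∈ G := fun l => .inl ⟨l, rfl⟩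
  have hxG : ∀ l m, x l * h m ∈ G := fun l m => .inr ⟨(l, m), rfl⟩
  let I : Ideal B := (Submodule.span B G).comap (Algebra.linearMap B L)
  have hI : I ≠ ⊤ := fun H => hone (by
    have : (1 : B) ∈ I := H ▸ Submodule.mem_top
    simpa [I] using this)
  obtain ⟨M, hM, hIM⟩ := Ideal.exists_le_maximal I hI
  have hGM : ∀ g (hg : g ∈ G), (⟨g, hGB g hg⟩ : B) ∈ M := fun g hg =>
    hIM (Submodule.subset_span (R := B) hg)
  let H : B := ⟨h l₀, hGB _ (hhG l₀)⟩
  obtain ⟨φ, hφH, hφM⟩ := exists_algHom_powerSeries_of_isMaximal k B M H (hGM _ (hhG l₀))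
    fun H0 => hl₀ (congrArg Subtype.val H0)
  let Φ : B →+* LaurentSeries k := (HahnSeries.ofPowerSeries ℤ k).comp φ.toRingHom
  have hΦH : Φ H ≠ 0 := fun H0 =>
    hφH (HahnSeries.ofPowerSeries_injective (H0.trans (map_zero _).symm))
  have hΦC : ∀ a : k, Φ (algebraMap k B a) = HahnSeries.C a := fun a => by
    simp [Φ]
  have hΦM : ∀ v ∈ M, 0 < (Φ v).orderTop := fun v hv => by
    refine lt_of_lt_of_le (b := ((1 : ℤ) : WithTop ℤ)) (by simp) ?_
    rw [HahnSeries.le_orderTop_iff_forall]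
    intro j hj
    have hj' : j < 1 := by exact_mod_cast hj
    refine (PowerSeries.coeff_coe (φ v) j).trans ?_
    split_ifs with h0
    · rfl
    · rw [show j = 0 by omega]
      simpa using hφM v hv
  let ξ : σ → LaurentSeries k := fun l => Φ ⟨_, hGB _ (hxG l l₀)⟩ / Φ H
  let ι : ℂ →+* LaurentSeries k := HahnSeries.C.comp (algebraMap ℂ k)
  let Good : L → LaurentSeries k → Prop := fun y z =>
    ∃ (N : ℕ) (b : B), (b : L) = h l₀ ^ N * y ∧ Φ b = Φ H ^ N * z
  have good_coe : ∀ b : B, Good b (Φ b) := fun b => ⟨0, b, by simp, by simp⟩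
  have good_add : ∀ {y z y' z'}, Good y z → Good y' z' → Good (y + y') (z + z') := by
    rintro y z y' z' ⟨N, b, hb, hb'⟩ ⟨N', b', hc, hc'⟩
    refine ⟨N + N', H ^ N' * b + H ^ N * b', ?_, ?_⟩
    · push_cast; rw [hb, hc]; simp only [H]; ring
    · rw [map_add, map_mul, map_mul, map_pow, map_pow, hb', hc']; ring
  have good_mul : ∀ {y z y' z'}, Good y z → Good y' z' → Good (y * y') (z * z') := by
    rintro y z y' z' ⟨N, b, hb, hb'⟩ ⟨N', b', hc, hc'⟩
    refine ⟨N + N', b * b', ?_, ?_⟩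
    · push_cast; rw [hb, hc]; ring
    · rw [map_mul, hb', hc']; ring
  have good_unique : ∀ {y z z'}, Good y z → Good y z' → z = z' := by
    rintro y z z' ⟨N, b, hb, hb'⟩ ⟨N', b', hc, hc'⟩
    have : H ^ N' * b = H ^ N * b' := Subtype.ext (by push_cast; rw [hb, hc]; simp only [H]; ring)
    have h2 := congrArg Φ this
    rw [map_mul, map_mul, map_pow, map_pow, hb', hc'] at h2
    have h3 : (Φ H ^ N' * Φ H ^ N) * z = (Φ H ^ N' * Φ H ^ N) * z' := by linear_combination h2
    exact mul_left_cancel₀ (mul_ne_zero (pow_ne_zero _ hΦH) (pow_ne_zero _ hΦH)) h3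
  have good_aeval : ∀ q : MvPolynomial σ ℂ, Good (aeval x q) (eval₂ ι ξ q) := by
    intro q
    induction q using MvPolynomial.induction_on with
    | C a =>
      have := good_coe (algebraMap k B (algebraMap ℂ k a))
      rw [hΦC] at this
      rw [eval₂_C, MvPolynomial.aeval_C, IsScalarTower.algebraMap_apply ℂ k L]
      exact this
    | add p q hp hq =>
      rw [map_add, eval₂_add]
      exact good_add hp hq
    | mul_X p l hp =>
      rw [map_mul, eval₂_mul, eval₂_X, MvPolynomial.aeval_X]
      refine good_mul hp ⟨1, ⟨_, hGB _ (hxG l l₀)⟩, by simp [mul_comm], ?_⟩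
      simp only [ξ, pow_one]
      rw [mul_div_cancel₀ _ hΦH]
  have hf : ∀ i, eval₂ ι ξ (f i) = HahnSeries.C (c i) := fun i => by
    refine good_unique (good_aeval (f i)) ?_
    rw [hc, ← hΦC]
    exact good_coe (algebraMap k B (c i))
  have hΦh : ∀ l, Φ ⟨h l, hGB _ (hhG l)⟩ = ∑ i, Φ ⟨μ i, hμB i⟩ * eval₂ ι ξ (pderiv l (f i)) :=
    fun l => by
    refine good_unique (good_coe _) ?_
    change Good (h l) _
    rw [hh l]
    exact Finset.sum_hom_rel ⟨0, 0, by simp, by simp⟩ fun i y z hyz =>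
      good_add (good_mul (good_coe ⟨μ i, hμB i⟩) (good_aeval _)) hyz
  have hξ : ∀ l m, Φ ⟨h m, hGB _ (hhG m)⟩ * ξ l = Φ ⟨_, hGB _ (hxG l m)⟩ := fun l m => by
    simp only [ξ]
    rw [← mul_div_assoc, div_eq_iff hΦH, ← map_mul, ← map_mul]
    congr 1
    refine Subtype.ext ?_
    simp only [H, MulMemClass.mk_mul_mk]
    ring
  have key : (1 : LaurentSeries k) = ∑ l, Φ ⟨h l, hGB _ (hhG l)⟩ * HahnSeries.map (ξ l) D := by
    calc (1 : LaurentSeries k)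
        = ∑ i, Φ ⟨μ i, hμB i⟩ * HahnSeries.map (eval₂ ι ξ (f i)) D := by
          simp only [hf, LaurentSeries.map_derivation_C, hD]
          rw [Finset.sum_eq_single i₀ (fun i _ hi => by simp [hi]) (by simp)]
          have : (⟨μ i₀, hμB i₀⟩ : B) = 1 := Subtype.ext hμ
          simp [this]
      _ = ∑ i, ∑ l, Φ ⟨μ i, hμB i⟩ * (eval₂ ι ξ (pderiv l (f i)) * HahnSeries.map (ξ l) D) := by
          refine Finset.sum_congr rfl fun i _ => ?_
          rw [LaurentSeries.map_derivation_eval₂ D ξ (f i), Finset.mul_sum]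
      _ = _ := by
          rw [Finset.sum_comm]
          refine Finset.sum_congr rfl fun l _ => ?_
          rw [hΦh, Finset.sum_mul]
          exact Finset.sum_congr rfl fun i _ => (mul_assoc _ _ _).symm
  have hcoeff := congrArg (fun z => HahnSeries.coeff z 0) key
  simp only [HahnSeries.coeff_one, if_true, HahnSeries.coeff_sum] at hcoeff
  refine one_ne_zero (hcoeff.trans (Finset.sum_eq_zero fun l _ => ?_))
  refine HahnSeries.coeff_eq_zero_of_lt_orderTop ?_
  have h1 := hΦM _ (hGM _ (hxG l l))
  rw [← hξ l l, HahnSeries.orderTop_mul] at h1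
  rw [HahnSeries.orderTop_mul]
  exact h1.trans_le (add_le_add_right (LaurentSeries.orderTop_le_map_derivation D _) _)

/-- An ideal which meets `A` trivially stays proper after adjoining elements algebraic over
`A`. -/
theorem one_notMem_span_adjoin_of_isAlgebraic {A k L : Type*} [CommRing A] [IsDomain A] [Field k]
    [Field L] [Algebra A L] [Algebra k L] (hk : ∀ c : k, IsAlgebraic A (algebraMap k L c))
    (S G : Set L) (hGS : G ⊆ S)
    (hG : ∀ a : A, a ≠ 0 → algebraMap A L a ∉ Submodule.span (Algebra.adjoin A S) G) :
    (1 : L) ∉ Submodule.span (Algebra.adjoin k S) G := by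
  set B₀ := Algebra.adjoin A S with hB₀
  let I : Ideal B₀ := (Submodule.span B₀ G).comap (Algebra.linearMap B₀ L)
  have hdisj : Disjoint (I : Set B₀) ((nonZeroDivisors A).map (algebraMap A B₀)) := by
    rw [Set.disjoint_left]
    rintro _ hb ⟨a, ha, rfl⟩
    exact hG a (nonZeroDivisors.ne_zero ha) hb
  obtain ⟨M, hM, hIM, hMd⟩ := Ideal.exists_le_prime_disjoint I _ hdisj
  obtain ⟨Q, -, hQ, hQM⟩ := Ideal.exists_ideal_over_prime_of_isIntegral
    (S := integralClosure B₀ L) M ⊥ (by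
      refine (Ideal.comap_bot_of_injective (algebraMap B₀ (integralClosure B₀ L)) ?_).le.trans bot_le
      intro a b hab
      exact Subtype.ext (congrArg (fun z : integralClosure B₀ L => (z : L)) hab))
  have hbase : ∀ b ∈ B₀, b ∈ integralClosure B₀ L := fun b hb =>
    isIntegral_algebraMap (R := B₀) (x := ⟨b, hb⟩)
  have hB : ∀ b ∈ Algebra.adjoin k S, ∃ a : A, a ≠ 0 ∧ a • b ∈ integralClosure B₀ L := by
    intro b hb
    induction hb using Algebra.adjoin_induction with
    | mem b hb => exact ⟨1, one_ne_zero, by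
        rw [one_smul]; exact hbase b (Algebra.subset_adjoin hb)⟩
    | algebraMap c =>
      obtain ⟨a, ha, hint⟩ := (hk c).exists_integral_multiple
      exact ⟨a, ha, hint.tower_top⟩
    | add x y _ _ hx hy =>
      obtain ⟨a, ha, hx⟩ := hx
      obtain ⟨b, hb, hy⟩ := hy
      refine ⟨a * b, mul_ne_zero ha hb, ?_⟩
      have : (a * b) • (x + y) = algebraMap A L b * (a • x) + algebraMap A L a * (b • y) := by
        simp only [Algebra.smul_def, map_mul]; ring
      rw [this]
      exact add_mem (mul_mem (hbase _ (algebraMap_mem _ _)) hx)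
        (mul_mem (hbase _ (algebraMap_mem _ _)) hy)
    | mul x y _ _ hx hy =>
      obtain ⟨a, ha, hx⟩ := hx
      obtain ⟨b, hb, hy⟩ := hy
      refine ⟨a * b, mul_ne_zero ha hb, ?_⟩
      rw [mul_smul_mul_comm]
      exact mul_mem hx hy
  have hQa : ∀ a : A, ∀ z : integralClosure B₀ L, z ∈ Q → ∃ w ∈ Q, (w : L) = a • (z : L) :=
    fun a z hz => ⟨⟨_, hbase _ (algebraMap_mem B₀ a)⟩ * z, Q.mul_mem_left _ hz, by
      rw [Algebra.smul_def]; rfl⟩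
  have hspan : ∀ z ∈ Submodule.span (Algebra.adjoin k S) G,
      ∃ a : A, a ≠ 0 ∧ ∃ w ∈ Q, (w : L) = a • z := by
    intro z hz
    induction hz using Submodule.span_induction with
    | mem g hg =>
      have hgB : g ∈ B₀ := Algebra.subset_adjoin (hGS hg)
      refine ⟨1, one_ne_zero, ⟨g, hbase g hgB⟩, ?_, (one_smul _ _).symm⟩
      have : (⟨g, hgB⟩ : B₀) ∈ M := hIM (Submodule.subset_span (R := B₀) hg)
      rw [← hQM] at this
      exact this
    | zero => exact ⟨1, one_ne_zero, 0, Q.zero_mem, by simp⟩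
    | add x y _ _ hx hy =>
      obtain ⟨a, ha, v, hv, hx⟩ := hx
      obtain ⟨b, hb, w, hw, hy⟩ := hy
      obtain ⟨v', hv', hx'⟩ := hQa b v hv
      obtain ⟨w', hw', hy'⟩ := hQa a w hw
      refine ⟨a * b, mul_ne_zero ha hb, v' + w', Q.add_mem hv' hw', ?_⟩
      push_cast
      rw [hx', hy', hx, hy, smul_add, mul_smul, mul_smul, smul_comm a b x]
    | smul b x _ hx =>
      obtain ⟨a, ha, v, hv, hx⟩ := hx
      obtain ⟨c, hc, hb⟩ := hB b b.2
      refine ⟨c * a, mul_ne_zero hc ha, ⟨_, hb⟩ * v, Q.mul_mem_left _ hv, ?_⟩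
      push_cast
      rw [hx, Algebra.smul_def b x, mul_smul_mul_comm]
      rfl
  intro h1
  obtain ⟨a, ha, w, hw, hwa⟩ := hspan 1 h1
  have haM : algebraMap A B₀ a ∈ M := by
    rw [← hQM, Ideal.mem_comap]
    convert hw
    refine Subtype.ext ?_
    rw [hwa, Algebra.smul_def, mul_one]
    rfl
  exact Set.disjoint_left.1 hMd haM ⟨a, mem_nonZeroDivisors_of_ne_zero ha, rfl⟩

theorem MvPolynomial.eq_C_of_pderiv_eq_zero {σ R : Type*} [CommRing R] [IsDomain R] [CharZero R]
    {f : MvPolynomial σ R} (hf : ∀ i, pderiv i f = 0) : f = C (coeff 0 f) := by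
  classical
  ext m
  rw [coeff_C]
  split_ifs with h
  · rw [h]
  · obtain ⟨i, hi⟩ : ∃ i, m i ≠ 0 := by
      by_contra! H
      exact h (Finsupp.ext fun i => (H i).symm)
    have hm : m - Finsupp.single i 1 + Finsupp.single i 1 = m :=
      tsub_add_cancel_of_le (by simpa [Nat.one_le_iff_ne_zero] using hi)
    have := coeff_pderiv (i := i) f (m - Finsupp.single i 1)
    rw [hf, hm, coeff_zero] at this
    refine (mul_eq_zero.1 this.symm).resolve_right ?_
    exact Nat.cast_add_one_ne_zero _

theorem AlgebraicIndependent.exists_pderiv_ne_zero {σ τ R : Type*} [CommRing R] [IsDomain R]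
    [CharZero R] {f : τ → MvPolynomial σ R} (hf : AlgebraicIndependent R f) (i : τ) :
    ∃ l, pderiv l (f i) ≠ 0 := by
  by_contra! H
  have h := MvPolynomial.eq_C_of_pderiv_eq_zero H
  have hX : (X i : MvPolynomial τ R) = C (coeff 0 (f i)) := hf (by
    rw [aeval_X, aeval_C]; exact h)
  have := congrArg (eval fun _ => coeff 0 (f i) + 1) hX
  simp at this

theorem exists_ne_zero_algebraMap_mem_span {σ τ L : Type*} [Finite σ] [Fintype τ] [DecidableEq τ]
    [Field L] [IsAlgClosed L] [Algebra ℂ L] [Algebra (MvPolynomial τ ℂ) L]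
    [IsScalarTower ℂ (MvPolynomial τ ℂ) L] [FaithfulSMul (MvPolynomial τ ℂ) L]
    (f : τ → MvPolynomial σ ℂ) (x : σ → L) (μ : τ → L) (h : σ → L) (i₀ : τ) (hμ : μ i₀ = 1)
    (hf : ∀ i, aeval x (f i) = algebraMap (MvPolynomial τ ℂ) L (X i))
    (hh : ∀ l, h l = ∑ i, μ i * aeval x (pderiv l (f i))) {l₀ : σ} (hl₀ : h l₀ ≠ 0) :
    ∃ a : MvPolynomial τ ℂ, a ≠ 0 ∧ algebraMap (MvPolynomial τ ℂ) L a ∈ Submodule.span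
      (Algebra.adjoin (MvPolynomial τ ℂ)
        (Set.range μ ∪ (Set.range h ∪ Set.range fun q : σ × σ => x q.1 * h q.2)))
      (Set.range h ∪ Set.range fun q : σ × σ => x q.1 * h q.2) := by
  have := Fintype.ofFinite σ
  by_contra! H
  let _ : Algebra (FractionRing (MvPolynomial τ ℂ)) L :=
    FractionRing.liftAlgebra (MvPolynomial τ ℂ) L
  have : IsScalarTower ℂ (FractionRing (MvPolynomial τ ℂ)) L := .to₁₃₄ ℂ (MvPolynomial τ ℂ) _ _
  let k := algebraicClosure (FractionRing (MvPolynomial τ ℂ)) L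
  have : IsAlgClosed k :=
    (algebraicClosure.isAlgClosure (FractionRing (MvPolynomial τ ℂ)) L).isAlgClosed
  have : Algebra.IsAlgebraic (MvPolynomial τ ℂ) k :=
    (IsFractionRing.comap_isAlgebraic_iff (K := FractionRing (MvPolynomial τ ℂ))).2 inferInstance
  have : FaithfulSMul (MvPolynomial τ ℂ) k := (faithfulSMul_iff_algebraMap_injective _ _).2
    fun a b hab => FaithfulSMul.algebraMap_injective (MvPolynomial τ ℂ) L
      (congrArg (algebraMap k L) hab)
  have : IsScalarTower ℂ (MvPolynomial τ ℂ) k := .of_algebraMap_eq fun z =>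
    Subtype.ext (IsScalarTower.algebraMap_apply ℂ (MvPolynomial τ ℂ) L z)
  have : IsScalarTower ℂ k L := .of_algebraMap_eq fun _ => rfl
  have : IsScalarTower (MvPolynomial τ ℂ) k L := .of_algebraMap_eq fun _ => rfl
  obtain ⟨D, hD⟩ := exists_derivation_apply_X (ι := τ) k i₀
  refine one_notMem_span_adjoin_of_isAlgebraic (A := MvPolynomial τ ℂ) (k := k) ?_ _ _
    Set.subset_union_right H (one_mem_span_of_derivation f x μ h
    (fun i => algebraMap (MvPolynomial τ ℂ) k (X i)) i₀ D hD hμ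
    (fun i => (hf i).trans (IsScalarTower.algebraMap_apply _ k L _)) hh hl₀)
  exact fun c => (Algebra.IsAlgebraic.isAlgebraic c).algebraMap

section

variable {σ τ : Type*} [Fintype τ] [DecidableEq τ]

/-- The `i`-th multiplier, normalised to be `1` at `i₀`. -/
noncomputable def multiplier (σ : Type*) {τ : Type*} [DecidableEq τ] (i₀ i : τ) :
    MvPolynomial (σ ⊕ τ) ℂ :=
  if i = i₀ then 1 else X (.inr i)

/-- The `l`-th coordinate of the combination of the gradients of the `f i` with coefficients the
multipliers. -/
noncomputable def lagrangeGradient (f : τ → MvPolynomial σ ℂ) (i₀ : τ) (l : σ) :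
    MvPolynomial (σ ⊕ τ) ℂ :=
  ∑ i, multiplier σ i₀ i * rename Sum.inl (pderiv l (f i))

/-- The coordinates of the gradient combination together with their multiples by the variables. -/
def malgrangeSet (f : τ → MvPolynomial σ ℂ) (i₀ : τ) : Set (MvPolynomial (σ ⊕ τ) ℂ) :=
  Set.range (lagrangeGradient f i₀) ∪
    Set.range fun q : σ × σ => X (.inl q.1) * lagrangeGradient f i₀ q.2

/-- The algebra generated by the components of `f`, the multipliers and `malgrangeSet`. -/
noncomputable def malgrangeAlgebra (f : τ → MvPolynomial σ ℂ) (i₀ : τ) :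
    Subalgebra ℂ (MvPolynomial (σ ⊕ τ) ℂ) :=
  Algebra.adjoin ℂ (Set.range (fun i => rename Sum.inl (f i)) ∪
    (Set.range (multiplier σ i₀) ∪ malgrangeSet f i₀))

theorem exists_lagrangeGradient_ne_zero {f : τ → MvPolynomial σ ℂ} (hf : AlgebraicIndependent ℂ f)
    (i₀ : τ) : ∃ l, lagrangeGradient f i₀ l ≠ 0 := by
  obtain ⟨l, hl⟩ := hf.exists_pderiv_ne_zero i₀
  refine ⟨l, fun H => hl ?_⟩
  have := congrArg (aeval (Sum.elim (X : σ → MvPolynomial σ ℂ) fun _ => 0)) H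
  simpa [lagrangeGradient, multiplier, apply_ite, bind₁_rename, bind₁_X_left] using this

/-- Pulling back the relation provided by `exists_ne_zero_algebraMap_mem_span` to polynomials. -/
theorem exists_ne_zero_aeval_mem_span_of_injective [Finite σ] {f : τ → MvPolynomial σ ℂ}
    (hf : AlgebraicIndependent ℂ f) (i₀ : τ) {L : Type*} [Field L] [IsAlgClosed L] [Algebra ℂ L]
    (κ : MvPolynomial (σ ⊕ τ) ℂ →ₐ[ℂ] L) (hκ : Function.Injective κ) :
    ∃ g : MvPolynomial τ ℂ, g ≠ 0 ∧ rename Sum.inl (aeval f g) ∈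
      Submodule.span (malgrangeAlgebra f i₀) (malgrangeSet f i₀) := by
  let ρ : MvPolynomial τ ℂ →ₐ[ℂ] L := (κ.comp (rename Sum.inl)).comp (aeval f)
  have hρ : Function.Injective ρ :=
    (hκ.comp (rename_injective _ Sum.inl_injective)).comp hf
  let _ : Algebra (MvPolynomial τ ℂ) L := ρ.toRingHom.toAlgebra
  have : IsScalarTower ℂ (MvPolynomial τ ℂ) L := .of_algebraMap_eq' ρ.comp_algebraMap.symm
  have : FaithfulSMul (MvPolynomial τ ℂ) L := (faithfulSMul_iff_algebraMap_injective _ _).2 hρ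
  obtain ⟨l₀, hl₀⟩ := exists_lagrangeGradient_ne_zero hf i₀
  have haeval : ∀ q : MvPolynomial σ ℂ, aeval (fun l => κ (X (.inl l))) q = κ (rename Sum.inl q) :=
    fun q => by
    change _ = (κ.comp (rename Sum.inl)) q
    congr 1
    exact MvPolynomial.algHom_ext fun i => by simp
  obtain ⟨a, ha, hspan⟩ := exists_ne_zero_algebraMap_mem_span f (fun l => κ (X (.inl l)))
    (fun i => κ (multiplier σ i₀ i)) (fun l => κ (lagrangeGradient f i₀ l)) i₀
    (by simp [multiplier])
    (fun i => by
      rw [haeval]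
      change _ = κ (rename Sum.inl (aeval f (X i)))
      rw [aeval_X])
    (fun l => by simp [lagrangeGradient, haeval]) (l₀ := l₀)
    (fun h0 => hl₀ (hκ (h0.trans (map_zero κ).symm)))
  have hB : ∀ b ∈ Algebra.adjoin (MvPolynomial τ ℂ)
      (κ '' (Set.range (multiplier σ i₀) ∪ malgrangeSet f i₀)),
      ∃ b' ∈ malgrangeAlgebra f i₀, κ b' = b := by
    intro b hb
    induction hb using Algebra.adjoin_induction with
    | mem b hb =>
      obtain ⟨b', hb', rfl⟩ := hb
      exact ⟨b', Algebra.subset_adjoin (.inr hb'), rfl⟩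
    | algebraMap c =>
      refine ⟨rename Sum.inl (aeval f c), ?_, rfl⟩
      rw [comp_aeval_apply]
      refine Algebra.adjoin_mono Set.subset_union_left ?_
      rw [Algebra.adjoin_range_eq_range_aeval]
      exact ⟨c, rfl⟩
    | add x y _ _ hx hy =>
      obtain ⟨x', hx, rfl⟩ := hx
      obtain ⟨y', hy, rfl⟩ := hy
      exact ⟨_, add_mem hx hy, map_add _ _ _⟩
    | mul x y _ _ hx hy =>
      obtain ⟨x', hx, rfl⟩ := hx
      obtain ⟨y', hy, rfl⟩ := hy
      exact ⟨_, mul_mem hx hy, map_mul _ _ _⟩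
  have hS : ∀ z ∈ Submodule.span (Algebra.adjoin (MvPolynomial τ ℂ)
      (κ '' (Set.range (multiplier σ i₀) ∪ malgrangeSet f i₀))) (κ '' malgrangeSet f i₀),
      ∃ z' ∈ Submodule.span (malgrangeAlgebra f i₀) (malgrangeSet f i₀), κ z' = z := by
    intro z hz
    induction hz using Submodule.span_induction with
    | mem g hg =>
      obtain ⟨g', hg', rfl⟩ := hg
      exact ⟨g', Submodule.subset_span hg', rfl⟩
    | zero => exact ⟨0, zero_mem _, map_zero _⟩
    | add x y _ _ hx hy =>
      obtain ⟨x', hx, rfl⟩ := hx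
      obtain ⟨y', hy, rfl⟩ := hy
      exact ⟨_, add_mem hx hy, map_add _ _ _⟩
    | smul b x _ hx =>
      obtain ⟨x', hx, rfl⟩ := hx
      obtain ⟨b', hb, hbb⟩ := hB b b.2
      exact ⟨_, Submodule.smul_mem _ (⟨b', hb⟩ : malgrangeAlgebra f i₀) hx,
        (map_mul κ b' x').trans (by rw [hbb]; rfl)⟩
  have himage : κ '' malgrangeSet f i₀ =
      Set.range (fun l => κ (lagrangeGradient f i₀ l)) ∪
        Set.range fun q : σ × σ => κ (X (.inl q.1)) * κ (lagrangeGradient f i₀ q.2) := by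
    simp only [malgrangeSet, Set.image_union, ← Set.range_comp, Function.comp_def, map_mul]
  obtain ⟨z, hz, hza⟩ := hS (algebraMap (MvPolynomial τ ℂ) L a) (by
    rw [Set.image_union, himage, ← Set.range_comp]
    exact hspan)
  refine ⟨a, ha, ?_⟩
  rwa [← show z = rename Sum.inl (aeval f a) from hκ hza]

theorem exists_ne_zero_aeval_mem_span_malgrangeSet [Finite σ] {f : τ → MvPolynomial σ ℂ}
    (hf : AlgebraicIndependent ℂ f) (i₀ : τ) :
    ∃ g : MvPolynomial τ ℂ, g ≠ 0 ∧ rename Sum.inl (aeval f g) ∈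
      Submodule.span (malgrangeAlgebra f i₀) (malgrangeSet f i₀) :=
  exists_ne_zero_aeval_mem_span_of_injective hf i₀
    (IsScalarTower.toAlgHom ℂ (MvPolynomial (σ ⊕ τ) ℂ)
      (AlgebraicClosure (FractionRing (MvPolynomial (σ ⊕ τ) ℂ))))
    ((algebraMap (FractionRing (MvPolynomial (σ ⊕ τ) ℂ)) _).injective.comp
      (IsFractionRing.injective (MvPolynomial (σ ⊕ τ) ℂ) _))

end

theorem eucNorm_eq_norm_toLp {m : ℕ} (v : Fin m → ℂ) : eucNorm v = ‖WithLp.toLp 2 v‖ := by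
  rw [EuclideanSpace.norm_eq]; rfl

theorem norm_apply_le_eucNorm {m : ℕ} (v : Fin m → ℂ) (i : Fin m) : ‖v i‖ ≤ eucNorm v := by
  rw [eucNorm_eq_norm_toLp]
  exact PiLp.norm_apply_le (WithLp.toLp 2 v) i

theorem pdiff_eq_inner {n p : ℕ} (f : Fin p → MvPolynomial (Fin n) ℂ) (x : Fin n → ℂ) (j : Fin p)
    (v : EuclideanSpace ℂ (Fin n)) :
    pdiff f x j v = inner ℂ (WithLp.toLp 2 fun l => star (eval x (pderiv l (f j)))) v := by
  simp [pdiff, PiLp.inner_apply, mul_comm]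

/-- The norm of `w_j(x)` bounds some combination of the gradients with `j`-th coefficient `1`. -/
theorem exists_multiplier_norm_le_wNorm {n p : ℕ} (f : Fin p → MvPolynomial (Fin n) ℂ)
    (x : Fin n → ℂ) (j : Fin p) :
    ∃ μ : Fin p → ℂ, μ j = 1 ∧ ∀ l, ‖∑ i, μ i * eval x (pderiv l (f i))‖ ≤ wNorm f x j := by
  let u : Fin p → EuclideanSpace ℂ (Fin n) := fun i =>
    WithLp.toLp 2 fun l => star (eval x (pderiv l (f i)))
  let u' : Fin p → EuclideanSpace ℂ (Fin n) := fun i => if i = j then 0 else u i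
  let W := Submodule.span ℂ (Set.range u')
  let v := u j - W.starProjection (u j)
  have hvW : ∀ w ∈ W, inner ℂ w v = 0 := (Submodule.mem_orthogonal _ _).1
    (W.sub_starProjection_mem_orthogonal (u j))
  obtain ⟨c, hc⟩ := (Submodule.mem_span_range_iff_exists_fun ℂ).1
    (W.starProjection_apply_mem (u j))
  have hinner : inner ℂ (u j) v = ‖v‖ ^ 2 := by
    have h1 : inner ℂ v v = inner ℂ (u j) v := by
      rw [show v = u j - W.starProjection (u j) from rfl, inner_sub_left,
        hvW _ (W.starProjection_apply_mem (u j)), sub_zero]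
    rw [← h1, inner_self_eq_norm_sq_to_K]; rfl
  have hother : ∀ i ≠ j, inner ℂ (u i) v = 0 := fun i hi => hvW _
    (Submodule.subset_span ⟨i, by simp [u', hi]⟩)
  have hbdd : BddAbove { r : ℝ | ∃ v : Fin n → ℂ,
      (∀ i : Fin p, i ≠ j → pdiff f x i v = 0) ∧ eucNorm v ≤ 1 ∧ r = ‖pdiff f x j v‖ } := by
    refine ⟨‖u j‖, ?_⟩
    rintro r ⟨w, -, hw, rfl⟩
    rw [show pdiff f x j w = inner ℂ (u j) (WithLp.toLp 2 w) from
      pdiff_eq_inner f x j (WithLp.toLp 2 w)]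
    refine (norm_inner_le_norm _ _).trans ?_
    rw [eucNorm_eq_norm_toLp] at hw
    exact mul_le_of_le_one_right (norm_nonneg _) hw
  have hv : ‖v‖ ≤ wNorm f x j := by
    rcases eq_or_ne v 0 with h0 | h0
    · rw [h0, norm_zero]
      exact Real.sSup_nonneg (by rintro r ⟨w, -, -, rfl⟩; exact norm_nonneg _)
    have hn : ‖v‖ ≠ 0 := norm_ne_zero_iff.2 h0
    refine le_csSup hbdd ⟨((‖v‖ : ℂ)⁻¹ • v : EuclideanSpace ℂ (Fin n)), fun i hi => ?_, ?_, ?_⟩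
    · rw [pdiff_eq_inner, inner_smul_right]
      exact mul_eq_zero_of_right _ (hother i hi)
    · rw [eucNorm_eq_norm_toLp, WithLp.toLp_ofLp, norm_smul]
      simp [hn]
    · rw [pdiff_eq_inner, inner_smul_right]
      change _ = ‖_ * inner ℂ (u j) v‖
      rw [hinner]
      simp [sq, hn]
  refine ⟨fun i => if i = j then 1 else -star (c i), by simp, fun l => ?_⟩
  refine le_trans (le_of_eq ?_) ((PiLp.norm_apply_le v l).trans hv)
  have hvl : v = u j - ∑ i, c i • u' i := by rw [hc]
  have hu' : ∀ i, u' i l = if i = j then 0 else star (eval x (pderiv l (f i))) := fun i => by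
    by_cases hi : i = j <;> simp [u', u, hi]
  rw [← norm_star, star_sum, hvl, PiLp.sub_apply, WithLp.ofLp_sum, Finset.sum_apply]
  congr 1
  simp only [PiLp.smul_apply, hu']
  rw [show u j l = ∑ i, if i = j then star (eval x (pderiv l (f i))) else 0 by simp [u],
    ← Finset.sum_sub_distrib]
  refine Finset.sum_congr rfl fun i _ => ?_
  by_cases hi : i = j <;> simp [hi]

theorem exists_multiplier_norm_le_kuoDist {n p : ℕ} (hp : 1 ≤ p)
    (f : Fin p → MvPolynomial (Fin n) ℂ) (x : Fin n → ℂ) :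
    ∃ (k : Fin p) (μ : Fin p → ℂ), μ k = 1 ∧ (∀ i, ‖μ i‖ ≤ 1) ∧
      ∀ l, ‖∑ i, μ i * eval x (pderiv l (f i))‖ ≤ kuoDist f x := by
  have : Nonempty (Fin p) := ⟨⟨0, hp⟩⟩
  obtain ⟨j, hj⟩ := exists_eq_ciInf_of_finite (f := wNorm f x)
  obtain ⟨μ, hμj, hμ⟩ := exists_multiplier_norm_le_wNorm f x j
  obtain ⟨k, hk⟩ := Finite.exists_max fun i => ‖μ i‖
  have hk1 : 1 ≤ ‖μ k‖ := by simpa [hμj] using hk j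
  have hk0 : 0 < ‖μ k‖ := one_pos.trans_le hk1
  refine ⟨k, fun i => (μ k)⁻¹ * μ i, inv_mul_cancel₀ (norm_pos_iff.1 hk0), fun i => ?_,
    fun l => ?_⟩
  · rw [norm_mul, norm_inv, inv_mul_le_iff₀ hk0, mul_one]
    exact hk i
  · simp only [mul_assoc, ← Finset.mul_sum]
    rw [norm_mul, norm_inv, kuoDist, ← hj]
    exact (mul_le_of_le_one_left (norm_nonneg _) (inv_le_one_of_one_le₀ hk1)).trans (hμ l)

theorem tendsto_eval_of_mem_span_adjoin {ι α : Type*} {F : Filter α} {y : α → ι → ℂ}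
    {S T : Set (MvPolynomial ι ℂ)}
    (hS : ∀ s ∈ S, (fun t => eval (y t) s) =O[F] fun _ => (1 : ℝ))
    (hT : ∀ s ∈ T, Tendsto (fun t => eval (y t) s) F (nhds 0))
    {q : MvPolynomial ι ℂ} (hq : q ∈ Submodule.span (Algebra.adjoin ℂ S) T) :
    Tendsto (fun t => eval (y t) q) F (nhds 0) := by
  have hbdd : ∀ r ∈ Algebra.adjoin ℂ S, (fun t => eval (y t) r) =O[F] fun _ => (1 : ℝ) := by
    intro r hr
    induction hr using Algebra.adjoin_induction with
    | mem s hs => exact hS s hs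
    | algebraMap z =>
      simpa [MvPolynomial.algebraMap_eq] using
        Asymptotics.isBigO_const_const z (one_ne_zero (α := ℝ)) F
    | add r s _ _ h1 h2 => simpa using h1.add h2
    | mul r s _ _ h1 h2 => simpa using h1.mul h2
  induction hq using Submodule.span_induction with
  | mem s hs => exact hT s hs
  | zero => simpa using tendsto_const_nhds
  | add r s _ _ h1 h2 => simpa using h1.add h2
  | smul a r _ h =>
    have h' : (fun t => eval (y t) r) =o[F] fun _ => (1 : ℝ) :=
      (Asymptotics.isLittleO_one_iff ℝ).2 h
    have := (hbdd a a.2).mul_isLittleO h'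
    rw [← Asymptotics.isLittleO_one_iff ℝ]
    simpa [Subalgebra.smul_def] using this

theorem eval_eq_zero_of_aeval_mem_span {n p : ℕ} {f : Fin p → MvPolynomial (Fin n) ℂ}
    {k : Fin p} {g : MvPolynomial (Fin p) ℂ}
    (hg : rename Sum.inl (aeval f g) ∈ Submodule.span (malgrangeAlgebra f k) (malgrangeSet f k))
    {F : Filter ℕ} [F.NeBot] {x : ℕ → Fin n → ℂ} {μ : ℕ → Fin p → ℂ} {c : Fin p → ℂ}
    (hx : Tendsto (fun t => eucNorm (x t)) F atTop)
    (hc : Tendsto (fun t j => eval (x t) (f j)) F (nhds c))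
    (hκ : Tendsto (fun t => eucNorm (x t) * kuoDist f (x t)) F (nhds 0))
    (hμk : ∀ᶠ t in F, μ t k = 1) (hμ : ∀ t i, ‖μ t i‖ ≤ 1)
    (hμf : ∀ t l, ‖∑ i, μ t i * eval (x t) (pderiv l (f i))‖ ≤ kuoDist f (x t)) :
    eval c g = 0 := by
  let y : ℕ → Fin n ⊕ Fin p → ℂ := fun t => Sum.elim (x t) (μ t)
  have hy : ∀ (t : ℕ) (q : MvPolynomial (Fin n) ℂ),
      eval (y t) (rename Sum.inl q) = eval (x t) q := fun t q => by
    rw [eval_rename]; rfl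
  have hmult : ∀ᶠ t in F, ∀ i, eval (y t) (multiplier (Fin n) k i) = μ t i := by
    filter_upwards [hμk] with t ht i
    by_cases hi : i = k <;> simp [multiplier, hi, ht, y]
  have hgrad : ∀ᶠ t in F, ∀ l, ‖eval (y t) (lagrangeGradient f k l)‖ ≤ kuoDist f (x t) := by
    filter_upwards [hmult] with t ht l
    simpa [lagrangeGradient, ht, hy] using hμf t l
  have hT : ∀ s ∈ malgrangeSet f k, Tendsto (fun t => eval (y t) s) F (nhds 0) := by
    rintro s (⟨l, rfl⟩ | ⟨⟨l, m⟩, rfl⟩)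
    · refine squeeze_zero_norm' ?_ hκ
      filter_upwards [hgrad, hx.eventually_ge_atTop 1] with t ht hxt
      exact (ht l).trans (le_mul_of_one_le_left ((norm_nonneg _).trans (ht l)) hxt)
    · refine squeeze_zero_norm' ?_ hκ
      filter_upwards [hgrad] with t ht
      rw [map_mul, norm_mul, eval_X]
      exact mul_le_mul (norm_apply_le_eucNorm (x t) l) (ht m) (norm_nonneg _) (Real.sqrt_nonneg _)
  have hlim := tendsto_eval_of_mem_span_adjoin (y := y) (F := F) (fun s hs => ?_) hT hg
  · refine tendsto_nhds_unique ((((continuous_eval g).tendsto c).comp hc).congr fun t => ?_) hlim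
    rw [hy]
    change eval (fun j => eval (x t) (f j)) g = ((eval (x t)).comp (aeval f).toRingHom) g
    congr 1
    ext <;> simp
  · rcases hs with ⟨i, rfl⟩ | ⟨i, rfl⟩ | hs
    · simp only [hy]
      exact ((tendsto_pi_nhds.1 hc) i).isBigO_one ℝ
    · refine Asymptotics.IsBigO.of_bound 1 ?_
      filter_upwards [hmult] with t ht
      simpa [ht i] using hμ t i
    · exact (hT s hs).isBigO_one ℝ

/-- for a dominant polynomial map `f : ℂ^n → ℂ^p`, `K_∞(f)` has
codimension at least 1: there is a nonzero polynomial vanishing identically on it. -/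
theorem asymptotic_critical_values_not_dense
    {n p : ℕ} (hp : 1 ≤ p) (f : Fin p → MvPolynomial (Fin n) ℂ)
    (hdom : AlgebraicIndependent ℂ f) :
    ∃ g : MvPolynomial (Fin p) ℂ, g ≠ 0 ∧
      ∀ c ∈ Kinf f, MvPolynomial.eval c g = 0 := by
  choose g hg0 hg using fun k => exists_ne_zero_aeval_mem_span_malgrangeSet hdom k
  refine ⟨∏ k, g k, Finset.prod_ne_zero_iff.2 fun k _ => hg0 k, ?_⟩
  rintro c ⟨x, hx, hc, hκ⟩
  choose K μ hμK hμ hμf using fun t => exists_multiplier_norm_le_kuoDist hp f (x t)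
  obtain ⟨k, hk⟩ : ∃ k, ∃ᶠ t in atTop, K t = k := by
    by_contra H
    simp only [not_exists, not_frequently] at H
    obtain ⟨t, ht⟩ := (eventually_all.2 H).exists
    exact ht (K t) rfl
  have : NeBot (atTop ⊓ 𝓟 {t | K t = k}) := frequently_mem_iff_neBot.1 hk
  rw [map_prod]
  refine Finset.prod_eq_zero (Finset.mem_univ k) ?_
  refine eval_eq_zero_of_aeval_mem_span (F := atTop ⊓ 𝓟 {t | K t = k}) (hg k)
    (hx.mono_left inf_le_left) (hc.mono_left inf_le_left) (hκ.mono_left inf_le_left) ?_ hμ hμf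
  filter_upwards [mem_inf_of_right (mem_principal_self _)] with t ht
  exact (congrArg (μ t) ht).symm.trans (hμK t)
end

section
/- For every integer n ≥ 2, let f_n = z_1^2 + Σ_{i=2}^n (z_1 z_i − 1)^2 ∈ ℂ[z_1,…,z_n], viewed as a polynomial mapping ℂ^n → ℂ (so p = 1 and κ(df_n(x)) = ‖∇f_n(x)‖). Then 0 is an asymptotic critical value of f_n: there exists a sequence (x_t)_{t∈ℕ} in ℂ^n such that ‖x_t‖ → ∞, f_n(x_t) → 0 and ‖x_t‖·‖∇f_n(x_t)‖ → 0. -/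
open MvPolynomial Filter

/-- The set of asymptotic critical values of a polynomial map `f : ℂ^n → ℂ`
(the case `p = 1`, where the Kuo distance `κ(df(x))` is the Euclidean norm of the
gradient `∇f(x)`). -/
def Kinf1 {n : ℕ} (f : MvPolynomial (Fin n) ℂ) : Set ℂ :=
  { c | ∃ x : ℕ → (Fin n → ℂ),
      Tendsto (fun t => eucNorm (x t)) atTop atTop ∧
      Tendsto (fun t => MvPolynomial.eval (x t) f) atTop (nhds c) ∧
      Tendsto (fun t => eucNorm (x t) *
        eucNorm (fun k => MvPolynomial.eval (x t) (MvPolynomial.pderiv k f)))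
        atTop (nhds 0) }

/-- The polynomial `z₀² + ∑ᵢ (z₀ zᵢ₊₁ - 1)²` in `m + 1` variables. -/
noncomputable def kuoPoly (m : ℕ) : MvPolynomial (Fin (m + 1)) ℂ :=
  X 0 ^ 2 + ∑ i : Fin m, (X 0 * X i.succ - 1) ^ 2

/-- The curve `s ↦ (s, w, …, w)` with `w = s⁻¹ - s / m`, going to infinity as `s → 0`. -/
noncomputable def kuoCurve (m : ℕ) (s : ℝ) : Fin (m + 1) → ℂ :=
  Fin.cons (s : ℂ) fun _ => ((s⁻¹ - s / m : ℝ) : ℂ)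

theorem eucNorm_kuoCurve (m : ℕ) (s : ℝ) :
    eucNorm (kuoCurve m s) = √(s ^ 2 + m * (s⁻¹ - s / m) ^ 2) := by
  simp only [eucNorm, kuoCurve, Fin.sum_univ_succ, Fin.cons_zero, Fin.cons_succ,
    Complex.norm_real, Real.norm_eq_abs, sq_abs, Finset.sum_const, Finset.card_univ,
    Fintype.card_fin, nsmul_eq_mul]

theorem eval_kuoCurve_kuoPoly {m : ℕ} (hm : m ≠ 0) {s : ℝ} (hs : s ≠ 0) :
    eval (kuoCurve m s) (kuoPoly m) = ((s ^ 2 + s ^ 4 / m : ℝ) : ℂ) := by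
  have hm' : (m : ℂ) ≠ 0 := by exact_mod_cast hm
  have hs' : (s : ℂ) ≠ 0 := by exact_mod_cast hs
  simp [kuoPoly, kuoCurve]
  field_simp
  ring

theorem eval_kuoCurve_pderiv_zero {m : ℕ} (hm : m ≠ 0) {s : ℝ} (hs : s ≠ 0) :
    eval (kuoCurve m s) (pderiv 0 (kuoPoly m)) = ((2 * s ^ 3 / m : ℝ) : ℂ) := by
  have hm' : (m : ℂ) ≠ 0 := by exact_mod_cast hm
  have hs' : (s : ℂ) ≠ 0 := by exact_mod_cast hs
  simp [kuoPoly, kuoCurve, pderiv_X, Derivation.leibniz_pow]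
  field_simp
  ring

theorem eval_kuoCurve_pderiv_succ {m : ℕ} (hm : m ≠ 0) {s : ℝ} (hs : s ≠ 0) (j : Fin m) :
    eval (kuoCurve m s) (pderiv j.succ (kuoPoly m)) = ((-(2 * s ^ 3 / m) : ℝ) : ℂ) := by
  have hm' : (m : ℂ) ≠ 0 := by exact_mod_cast hm
  have hs' : (s : ℂ) ≠ 0 := by exact_mod_cast hs
  simp [kuoPoly, kuoCurve, pderiv_X, Derivation.leibniz_pow,
    Pi.single_apply, (Fin.succ_ne_zero _).symm]
  field_simp
  ring

theorem eucNorm_grad_kuoPoly {m : ℕ} (hm : m ≠ 0) {s : ℝ} (hs : s ≠ 0) :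
    eucNorm (fun k => eval (kuoCurve m s) (pderiv k (kuoPoly m))) =
      √((m + 1) * (2 * s ^ 3 / m) ^ 2) := by
  simp only [eucNorm, Fin.sum_univ_succ, eval_kuoCurve_pderiv_zero hm hs,
    eval_kuoCurve_pderiv_succ hm hs, Complex.norm_real, Real.norm_eq_abs, sq_abs,
    Finset.sum_const, Finset.card_univ, Fintype.card_fin, nsmul_eq_mul]
  congr 1
  ring

theorem zero_mem_Kinf1_kuoPoly {m : ℕ} (hm : m ≠ 0) : (0 : ℂ) ∈ Kinf1 (kuoPoly m) := by
  have hm' : (m : ℝ) ≠ 0 := by exact_mod_cast hm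
  have hm1 : (1 : ℝ) ≤ m := by exact_mod_cast Nat.one_le_iff_ne_zero.2 hm
  have hs (t : ℕ) : (1 / ((t : ℝ) + 1)) ≠ 0 := by positivity
  have lim := tendsto_one_div_add_atTop_nhds_zero_nat (𝕜 := ℝ)
  refine ⟨fun t => kuoCurve m (1 / ((t : ℝ) + 1)), ?_, ?_, ?_⟩
  · refine tendsto_atTop_mono (f := fun t : ℕ => (t : ℝ)) (fun t => ?_)
      tendsto_natCast_atTop_atTop
    rw [eucNorm_kuoCurve]
    apply Real.le_sqrt_of_sq_le
    have hs1 : 1 / ((t : ℝ) + 1) / m ≤ 1 := by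
      rw [div_div, div_le_one (by positivity)]
      nlinarith [(Nat.cast_nonneg t : (0 : ℝ) ≤ t)]
    have hw : (t : ℝ) ≤ (1 / ((t : ℝ) + 1))⁻¹ - 1 / ((t : ℝ) + 1) / m := by
      rw [one_div, inv_inv, ← one_div]
      linarith
    have hsq := pow_le_pow_left₀ (Nat.cast_nonneg t) hw 2
    nlinarith [sq_nonneg (1 / ((t : ℝ) + 1)),
      sq_nonneg ((1 / ((t : ℝ) + 1))⁻¹ - 1 / ((t : ℝ) + 1) / m)]
  · simp only [eval_kuoCurve_kuoPoly hm (hs _)]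
    have h : Continuous fun s : ℝ => ((s ^ 2 + s ^ 4 / m : ℝ) : ℂ) := by fun_prop
    simpa [Function.comp_def] using (h.tendsto 0).comp lim
  · have key (s : ℝ) (hs : s ≠ 0) : eucNorm (kuoCurve m s) *
        eucNorm (fun k => eval (kuoCurve m s) (pderiv k (kuoPoly m))) =
        √((m + 1) * (2 / m) ^ 2 * (s ^ 8 + m * s ^ 4 * (1 - s ^ 2 / m) ^ 2)) := by
      rw [eucNorm_kuoCurve, eucNorm_grad_kuoPoly hm hs, ← Real.sqrt_mul (by positivity)]
      congr 1
      field_simp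
    simp only [key _ (hs _)]
    have h : Continuous fun s : ℝ =>
        √((m + 1) * (2 / m) ^ 2 * (s ^ 8 + m * s ^ 4 * (1 - s ^ 2 / m) ^ 2)) := by fun_prop
    simpa [Function.comp_def] using (h.tendsto 0).comp lim

/-- for every `n ≥ 2`, `0` is an asymptotic critical value of
`f_n = z₁² + Σ_{i=2}^n (z₁ zᵢ − 1)² : ℂⁿ → ℂ`. -/
theorem zero_mem_Kinf_family (n : ℕ) (hn : 2 ≤ n) :
    (0 : ℂ) ∈ Kinf1
      ((X (⟨0, by omega⟩ : Fin n)) ^ 2 +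
        ∑ i ∈ Finset.univ.filter (fun i : Fin n => i ≠ ⟨0, by omega⟩),
          (X (⟨0, by omega⟩ : Fin n) * X i - 1) ^ 2) := by
  obtain ⟨m, rfl⟩ : ∃ m, n = m + 1 := ⟨n - 1, by omega⟩
  convert zero_mem_Kinf1_kuoPoly (m := m) (by omega) using 2
  rw [kuoPoly, Finset.sum_filter, Fin.sum_univ_succ]
  simp
end
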